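/- Let (X,d,μ) be a space of homogeneous type with μ(B) ≥ c r(B)^n for all balls B. Let 0<α<n, 1 < p < n/α and 1/q = 1/p − α/n. Then T_α maps L^p(μ) boundedly into L^q(μ): (∫_X (T_α|f|)^q dμ)^{1/q} ≤ C (∫_X |f|^p dμ)^{1/p}. -/

import Mathlib

open MeasureTheory Metric Set ENNReal NNReal

noncomputable section

variable {X : Type*} [MetricSpace X] [MeasurableSpace X] [BorelSpace X]

/-- Average of an `ℝ≥0∞`-valued function over a ball, w.r.t. `μ`. -/
def avgBX (μ : Measure X) (c : X) (r : ℝ) (g : X → ℝ≥0∞) : ℝ≥0∞ :=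
  (μ (ball c r))⁻¹ * ∫⁻ y in ball c r, g y ∂μ

/-- `(X, d, μ)` is a space of homogeneous type: balls have positive finite measure
and `μ` is doubling. -/
def IsSHT (μ : Measure X) : Prop :=
  (∀ (c : X) (r : ℝ), 0 < r → μ (ball c r) < ∞) ∧
  (∀ (c : X) (r : ℝ), 0 < r → 0 < μ (ball c r)) ∧
  ∃ D : ℝ≥0, ∀ (c : X) (r : ℝ), 0 < r → μ (ball c (2 * r)) ≤ D * μ (ball c r)

/-- Polynomial growth from below: `μ(B) ≥ c r(B)^n`. -/
def GrowthGE (μ : Measure X) (cl nd : ℝ) : Prop :=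
  ∀ (x : X) (r : ℝ), 0 < r → ENNReal.ofReal (cl * r ^ nd) ≤ μ (ball x r)

/-- Fractional maximal operator `M_β` on `(X, μ)` (`β = 0` gives the
Hardy–Littlewood maximal operator). -/
def maxFX (μ : Measure X) (β : ℝ) (g : X → ℝ≥0∞) (x : X) : ℝ≥0∞ :=
  ⨆ (c : X) (r : ℝ) (_ : 0 < r) (_ : x ∈ ball c r),
    ENNReal.ofReal (r ^ β) * avgBX μ c r g

/-- The `A_{p,q}(μ)` condition for `1 < p ≤ q < ∞`. -/
def ApqX (μ : Measure X) (p q : ℝ) (w : X → ℝ) : Prop :=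
  ∃ C : ℝ≥0, ∀ (c : X) (r : ℝ), 0 < r →
    (avgBX μ c r (fun x => ENNReal.ofReal (w x ^ q))) ^ (1 / q) *
      (avgBX μ c r (fun x => ENNReal.ofReal (w x ^ (-(p / (p - 1)))))) ^ (1 - 1 / p) ≤ C

/-- The `A_{1,q}(μ)` condition. -/
def A1qX (μ : Measure X) (q : ℝ) (w : X → ℝ) : Prop :=
  ∃ C : ℝ≥0, ∀ (c : X) (r : ℝ), 0 < r →
    ∀ᵐ x ∂(μ.restrict (ball c r)),
      (avgBX μ c r (fun y => ENNReal.ofReal (w y ^ q))) ^ (1 / q) ≤ C * ENNReal.ofReal (w x)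

/-- A doubling weight: the measure `w dμ` is doubling. -/
def WeightDoubling (μ : Measure X) (w : X → ℝ) : Prop :=
  ∃ D : ℝ≥0, ∀ (c : X) (r : ℝ), 0 < r →
    (∫⁻ x in ball c (2 * r), ENNReal.ofReal (w x) ∂μ) ≤
      D * ∫⁻ x in ball c r, ENNReal.ofReal (w x) ∂μ

/-- The fractional integral operator `T_α` applied to an `ℝ≥0∞`-valued function. -/
def TalphaE (μ : Measure X) (α : ℝ) (g : X → ℝ≥0∞) (x : X) : ℝ≥0∞ :=
  ∫⁻ y, (ENNReal.ofReal (dist x y ^ α) / μ (ball x (dist x y))) * g y ∂μ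

/-- The fractional integral operator `T_α` on real-valued functions. -/
def TalphaR (μ : Measure X) (α : ℝ) (f : X → ℝ) (x : X) : ℝ :=
  ∫ y, (dist x y ^ α / (μ (ball x (dist x y))).toReal) * f y ∂μ

theorem measure_ball_two_pow_mul_le {Y : Type*} [MetricSpace Y] [MeasurableSpace Y]
    {μ : Measure Y} {D : ℝ≥0}
    (hD : ∀ (c : Y) (r : ℝ), 0 < r → μ (ball c (2 * r)) ≤ D * μ (ball c r))
    (c : Y) {r : ℝ} (hr : 0 < r) (k : ℕ) :
    μ (ball c (2 ^ k * r)) ≤ (D : ℝ≥0∞) ^ k * μ (ball c r) := by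
  induction k with
  | zero => simp
  | succ k ih =>
    calc μ (ball c (2 ^ (k + 1) * r)) = μ (ball c (2 * (2 ^ k * r))) := by ring_nf
      _ ≤ D * μ (ball c (2 ^ k * r)) := hD c _ (by positivity)
      _ ≤ D * ((D : ℝ≥0∞) ^ k * μ (ball c r)) := by gcongr
      _ = (D : ℝ≥0∞) ^ (k + 1) * μ (ball c r) := by ring

theorem lt_maxFX_zero_iff {Y : Type*} [MetricSpace Y] [MeasurableSpace Y]
    {μ : Measure Y} {f : Y → ℝ≥0∞} {x : Y} {t : ℝ≥0∞} :
    t < maxFX μ 0 f x ↔ ∃ c r, 0 < r ∧ x ∈ ball c r ∧ t < avgBX μ c r f := by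
  simp only [maxFX, lt_iSup_iff, Real.rpow_zero, ENNReal.ofReal_one, one_mul, exists_prop]

theorem avgBX_le_maxFX_zero {Y : Type*} [MetricSpace Y] [MeasurableSpace Y]
    {μ : Measure Y} {f : Y → ℝ≥0∞} (x : Y) {r : ℝ} (hr : 0 < r) :
    avgBX μ x r f ≤ maxFX μ 0 f x :=
  le_of_forall_lt fun _ ht => lt_maxFX_zero_iff.2 ⟨x, r, hr, mem_ball_self hr, ht⟩

theorem measurable_maxFX_zero (μ : Measure X) (f : X → ℝ≥0∞) : Measurable (maxFX μ 0 f) := by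
  refine measurable_of_Ioi fun t => IsOpen.measurableSet ?_
  refine isOpen_iff_mem_nhds.2 fun x hx => ?_
  obtain ⟨c, r, hr, hxc, ht⟩ := lt_maxFX_zero_iff.1 hx
  filter_upwards [isOpen_ball.mem_nhds hxc] with y hy
  exact lt_maxFX_zero_iff.2 ⟨c, r, hr, hy, ht⟩

/-- Weak type `(1, 1)` estimate for the Hardy–Littlewood maximal operator. The lower growth of `μ`
bounds the radii of the balls with large averages, as the Vitali covering lemma requires. -/
theorem mul_measure_lt_maxFX_zero_le {μ : Measure X} [SFinite μ]
    (hpos : ∀ (c : X) (r : ℝ), 0 < r → 0 < μ (ball c r))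
    (hfin : ∀ (c : X) (r : ℝ), 0 < r → μ (ball c r) < ∞) {D : ℝ≥0}
    (hD : ∀ (c : X) (r : ℝ), 0 < r → μ (ball c (2 * r)) ≤ D * μ (ball c r))
    {cl nd : ℝ} (hcl : 0 < cl) (hnd : 0 < nd) (hgrowth : GrowthGE μ cl nd)
    {f : X → ℝ≥0∞} (hf : ∫⁻ x, f x ∂μ ≠ ∞) {t : ℝ≥0∞} (ht : t ≠ 0) :
    t * μ {x | t < maxFX μ 0 f x} ≤ (D : ℝ≥0∞) ^ 3 * ∫⁻ x, f x ∂μ := by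
  let S : Set (X × ℝ) := {b | 0 < b.2 ∧ t * μ (ball b.1 b.2) ≤ ∫⁻ y in ball b.1 b.2, f y ∂μ}
  let V : ℝ≥0∞ := (∫⁻ x, f x ∂μ) / t
  have hV : V ≠ ∞ := ENNReal.div_ne_top hf ht
  have hrad : ∀ b ∈ S, b.2 ≤ (V.toReal / cl) ^ nd⁻¹ := by
    rintro ⟨c, r⟩ ⟨hr, hb⟩
    have hle : μ (ball c r) ≤ V := by
      refine (ENNReal.le_div_iff_mul_le (.inl ht) (.inr hf)).2 ?_
      rw [mul_comm]
      exact hb.trans (setLIntegral_le_lintegral _ _)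
    have h1 := (ENNReal.ofReal_le_iff_le_toReal hV).1 ((hgrowth c r hr).trans hle)
    simp only at hr ⊢
    rw [Real.le_rpow_inv_iff_of_pos hr.le (by positivity) hnd, le_div_iff₀ hcl]
    linarith
  obtain ⟨u, huS, hdisj, hcov⟩ := Vitali.exists_disjoint_subfamily_covering_enlargement
    (fun b : X × ℝ => ball b.1 b.2) S Prod.snd 2 one_lt_two (fun b hb => hb.1.le) _ hrad
    (fun b hb => nonempty_ball.2 hb.1)
  have hdisj' : Pairwise (Function.onFun Disjoint fun b : u => ball b.1.1 b.1.2) :=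
    fun a b hab => hdisj a.2 b.2 (Subtype.coe_ne_coe.2 hab)
  have hcount : Countable u := by
    have h := Measure.countable_meas_pos_of_disjoint_iUnion (μ := μ)
      (fun b : u => measurableSet_ball (x := b.1.1) (ε := b.1.2)) hdisj'
    have huniv : {b : u | 0 < μ (ball b.1.1 b.1.2)} = univ :=
      eq_univ_of_forall fun b => hpos _ _ (huS b.2).1
    rwa [huniv, countable_univ_iff] at h
  have hsub : {x | t < maxFX μ 0 f x} ⊆ ⋃ b : u, ball b.1.1 (2 ^ 3 * b.1.2) := by
    intro x hx
    obtain ⟨c, r, hr, hxc, hlt⟩ := lt_maxFX_zero_iff.1 hx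
    have hmem : (c, r) ∈ S := by
      refine ⟨hr, ?_⟩
      rw [avgBX, ← ENNReal.div_eq_inv_mul] at hlt
      exact (ENNReal.le_div_iff_mul_le (.inl (hpos c r hr).ne') (.inl (hfin c r hr).ne)).1 hlt.le
    obtain ⟨b, hbu, ⟨z, hz1, hz2⟩, hle⟩ := hcov _ hmem
    refine mem_iUnion.2 ⟨⟨b, hbu⟩, ?_⟩
    have hb := (huS hbu).1
    simp only [mem_ball] at hz1 hz2 hxc hle ⊢
    have h1 := dist_triangle x c b.1
    have h2 := dist_triangle_left c b.1 z
    linarith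
  calc t * μ {x | t < maxFX μ 0 f x}
      ≤ t * ∑' b : u, (D : ℝ≥0∞) ^ 3 * μ (ball b.1.1 b.1.2) := by
        gcongr
        refine ((measure_mono hsub).trans (measure_iUnion_le _)).trans ?_
        exact ENNReal.tsum_le_tsum fun b => measure_ball_two_pow_mul_le hD _ (huS b.2).1 3
    _ = (D : ℝ≥0∞) ^ 3 * ∑' b : u, t * μ (ball b.1.1 b.1.2) := by
        rw [ENNReal.tsum_mul_left, ENNReal.tsum_mul_left, mul_left_comm]
    _ ≤ (D : ℝ≥0∞) ^ 3 * ∑' b : u, ∫⁻ y in ball b.1.1 b.1.2, f y ∂μ := by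
        gcongr with b
        exact (huS b.2).2
    _ = (D : ℝ≥0∞) ^ 3 * ∫⁻ y in ⋃ b : u, ball b.1.1 b.1.2, f y ∂μ := by
        rw [lintegral_iUnion (fun _ => measurableSet_ball) hdisj']
    _ ≤ (D : ℝ≥0∞) ^ 3 * ∫⁻ x, f x ∂μ := by
        gcongr
        exact Measure.restrict_le_self

theorem lintegral_Ioi_indicator_rpow {s : ℝ} (hs : 0 < s) (y : ℝ≥0∞) :
    ∫⁻ t in Ioi (0 : ℝ), {t | ENNReal.ofReal t < y}.indicator
      (fun t => ENNReal.ofReal (t ^ (s - 1))) t = y ^ s / ENNReal.ofReal s := by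
  have key : ∀ r : ℝ, 0 ≤ r →
      ∫⁻ t in Ioo 0 r, ENNReal.ofReal (t ^ (s - 1)) = ENNReal.ofReal r ^ s / ENNReal.ofReal s := by
    intro r hr
    have hint : IntervalIntegrable (fun t : ℝ => t ^ (s - 1)) volume 0 r :=
      intervalIntegral.intervalIntegrable_rpow' (by linarith)
    rw [← ofReal_integral_eq_lintegral_ofReal]
    · rw [← integral_Ioc_eq_integral_Ioo, ← intervalIntegral.integral_of_le hr,
        integral_rpow (.inl (by linarith)), sub_add_cancel, Real.zero_rpow hs.ne', sub_zero,
        ENNReal.ofReal_div_of_pos hs, ENNReal.ofReal_rpow_of_nonneg hr hs.le]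
    · exact ((intervalIntegrable_iff_integrableOn_Ioc_of_le hr).1 hint).mono_set Ioo_subset_Ioc_self
    · filter_upwards [ae_restrict_mem measurableSet_Ioo] with t ht
      exact Real.rpow_nonneg ht.1.le _
  have hmeas : MeasurableSet {t : ℝ | ENNReal.ofReal t < y} :=
    measurableSet_lt ENNReal.measurable_ofReal measurable_const
  rw [lintegral_indicator hmeas, Measure.restrict_restrict hmeas]
  induction y with
  | coe r =>
    have hset : {t : ℝ | ENNReal.ofReal t < r} ∩ Ioi 0 = Ioo 0 (r : ℝ) := by
      ext t
      simp only [mem_inter_iff, mem_ofPred_eq, mem_Ioi, mem_Ioo]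
      rw [and_comm]
      refine and_congr_right fun ht => ?_
      rw [ENNReal.ofReal_lt_iff_lt_toReal ht.le coe_ne_top, ENNReal.coe_toReal]
    rw [hset, key _ r.coe_nonneg, ENNReal.ofReal_coe_nnreal]
  | top =>
    rw [ENNReal.top_rpow_of_pos hs, ENNReal.top_div_of_ne_top ENNReal.ofReal_ne_top]
    refine ENNReal.eq_top_of_forall_nnreal_le fun r => ?_
    have hr : (0 : ℝ) ≤ (s * r) ^ s⁻¹ := by positivity
    calc (r : ℝ≥0∞) = ∫⁻ t in Ioo 0 ((s * r) ^ s⁻¹ : ℝ), ENNReal.ofReal (t ^ (s - 1)) := by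
          rw [key _ hr, ENNReal.ofReal_rpow_of_nonneg hr hs.le, Real.rpow_inv_rpow
            (by positivity) hs.ne', ← ENNReal.ofReal_div_of_pos hs, mul_div_cancel_left₀ _ hs.ne',
            ENNReal.ofReal_coe_nnreal]
      _ ≤ _ := by
          refine lintegral_mono_set fun t ht => ⟨ENNReal.ofReal_lt_top, ht.1⟩

/-- Weak type estimate in which only the large values of the function contribute. -/
theorem mul_measure_lt_maxFX_zero_le_indicator {μ : Measure X} [SFinite μ]
    (hpos : ∀ (c : X) (r : ℝ), 0 < r → 0 < μ (ball c r))
    (hfin : ∀ (c : X) (r : ℝ), 0 < r → μ (ball c r) < ∞) {D : ℝ≥0}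
    (hD : ∀ (c : X) (r : ℝ), 0 < r → μ (ball c (2 * r)) ≤ D * μ (ball c r))
    {cl nd : ℝ} (hcl : 0 < cl) (hnd : 0 < nd) (hgrowth : GrowthGE μ cl nd)
    {p : ℝ} (hp : 1 < p) {f : X → ℝ≥0∞} (hf : ∫⁻ x, f x ^ p ∂μ ≠ ∞)
    {t : ℝ≥0∞} (ht : t ≠ 0) (ht' : t ≠ ∞) :
    t * μ {x | t < maxFX μ 0 f x} ≤
      2 * (D : ℝ≥0∞) ^ 3 * ∫⁻ x, {x | t < 2 * f x}.indicator f x ∂μ := by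
  set g : X → ℝ≥0∞ := {x | t < 2 * f x}.indicator f with hg
  have hfg : ∀ x, f x ≤ t / 2 + g x := by
    intro x
    by_cases hx : t < 2 * f x
    · simp [hg, indicator_of_mem (show x ∈ {x | t < 2 * f x} from hx)]
    · refine le_add_right ?_
      rw [ENNReal.le_div_iff_mul_le (by simp) (by simp), mul_comm]
      exact not_lt.1 hx
  have ht2 : t / 2 ≠ 0 := (ENNReal.half_pos ht).ne'
  have ht2' : t / 2 ≠ ∞ := ENNReal.div_ne_top ht' two_ne_zero
  have hg_int : ∫⁻ x, g x ∂μ ≠ ∞ := by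
    have hle : ∀ x, g x ≤ (t / 2) ^ (1 - p) * f x ^ p := by
      intro x
      by_cases hx : t < 2 * f x
      · have hfx : t / 2 ≤ f x := by
          rw [mul_comm] at hx
          exact ENNReal.div_le_of_le_mul hx.le
        rw [hg, indicator_of_mem (show x ∈ {x | t < 2 * f x} from hx)]
        calc f x = ((t / 2) ^ (1 - p) * (t / 2) ^ (p - 1)) * f x := by
              rw [← ENNReal.rpow_add _ _ ht2 ht2']; simp
          _ ≤ ((t / 2) ^ (1 - p) * f x ^ (p - 1)) * f x := by
              gcongr
          _ = (t / 2) ^ (1 - p) * f x ^ p := by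
              rw [mul_assoc]
              congr 1
              nth_rw 2 [← ENNReal.rpow_one (f x)]
              rw [← ENNReal.rpow_add_of_nonneg _ _ (by linarith) zero_le_one, sub_add_cancel]
      · rw [hg, indicator_of_notMem (show x ∉ {x | t < 2 * f x} from hx)]
        exact zero_le
    have hc : (t / 2) ^ (1 - p) ≠ ∞ := by simp [ENNReal.rpow_eq_top_iff, ht2, ht2']
    refine ne_top_of_le_ne_top ?_ (lintegral_mono hle)
    rw [lintegral_const_mul' _ _ hc]
    exact ENNReal.mul_ne_top hc hf
  have hsub : {x | t < maxFX μ 0 f x} ⊆ {x | t / 2 < maxFX μ 0 g x} := by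
    intro x hx
    obtain ⟨c, r, hr, hxc, hlt⟩ := lt_maxFX_zero_iff.1 hx
    refine lt_maxFX_zero_iff.2 ⟨c, r, hr, hxc, lt_of_not_ge fun hge => hlt.not_ge ?_⟩
    calc avgBX μ c r f ≤ (μ (ball c r))⁻¹ * ∫⁻ y in ball c r, (t / 2 + g y) ∂μ := by
          unfold avgBX
          gcongr with y
          exact hfg y
      _ = t / 2 + avgBX μ c r g := by
          rw [lintegral_add_left measurable_const, setLIntegral_const, mul_add, avgBX,
            mul_left_comm, ENNReal.inv_mul_cancel (hpos c r hr).ne' (hfin c r hr).ne, mul_one]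
      _ ≤ t / 2 + t / 2 := by gcongr
      _ = t := ENNReal.add_halves t
  calc t * μ {x | t < maxFX μ 0 f x} ≤ t * μ {x | t / 2 < maxFX μ 0 g x} := by gcongr
    _ = 2 * (t / 2 * μ {x | t / 2 < maxFX μ 0 g x}) := by
        rw [← mul_assoc, ENNReal.mul_div_cancel two_ne_zero ofNat_ne_top]
    _ ≤ 2 * ((D : ℝ≥0∞) ^ 3 * ∫⁻ x, g x ∂μ) := by
        gcongr 2 * ?_
        exact mul_measure_lt_maxFX_zero_le hpos hfin hD hcl hnd hgrowth hg_int ht2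
    _ = _ := by rw [mul_assoc]

/-- Strong type `(p, p)` estimate for the Hardy–Littlewood maximal operator. -/
theorem lintegral_maxFX_zero_rpow_le {μ : Measure X} [SFinite μ]
    (hpos : ∀ (c : X) (r : ℝ), 0 < r → 0 < μ (ball c r))
    (hfin : ∀ (c : X) (r : ℝ), 0 < r → μ (ball c r) < ∞) {D : ℝ≥0}
    (hD : ∀ (c : X) (r : ℝ), 0 < r → μ (ball c (2 * r)) ≤ D * μ (ball c r))
    {cl nd : ℝ} (hcl : 0 < cl) (hnd : 0 < nd) (hgrowth : GrowthGE μ cl nd)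
    {p : ℝ} (hp : 1 < p) {f : X → ℝ≥0∞} (hfm : Measurable f) (hf : ∫⁻ x, f x ^ p ∂μ ≠ ∞) :
    ∫⁻ x, maxFX μ 0 f x ^ p ∂μ ≤
      ENNReal.ofReal p * (2 * (D : ℝ≥0∞) ^ 3) * (2 ^ (p - 1) / ENNReal.ofReal (p - 1)) *
        ∫⁻ x, f x ^ p ∂μ := by
  have hp0 : 0 < p := by linarith
  have hp1 : 0 < p - 1 := by linarith
  have hswap : ∀ (s : ℝ) (h g : X → ℝ≥0∞), Measurable h → Measurable g →
      ∫⁻ x, g x * (∫⁻ t in Ioi (0 : ℝ), {t | ENNReal.ofReal t < h x}.indicator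
        (fun t => ENNReal.ofReal (t ^ (s - 1))) t) ∂μ =
      ∫⁻ t in Ioi (0 : ℝ), ENNReal.ofReal (t ^ (s - 1)) *
        ∫⁻ x, {x | ENNReal.ofReal t < h x}.indicator g x ∂μ := by
    intro s h g hh hg
    have hmS : MeasurableSet {z : X × ℝ | ENNReal.ofReal z.2 < h z.1} :=
      measurableSet_lt (by fun_prop) (by fun_prop)
    have hmeas : Measurable (Function.uncurry fun (x : X) (t : ℝ) =>
        {z : X × ℝ | ENNReal.ofReal z.2 < h z.1}.indicator
          (fun z => g z.1 * ENNReal.ofReal (z.2 ^ (s - 1))) (x, t)) :=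
      Measurable.indicator (by fun_prop) hmS
    calc _ = ∫⁻ x, (∫⁻ t in Ioi (0 : ℝ), {z : X × ℝ | ENNReal.ofReal z.2 < h z.1}.indicator
          (fun z => g z.1 * ENNReal.ofReal (z.2 ^ (s - 1))) (x, t)) ∂μ := by
          refine lintegral_congr fun x => ?_
          rw [← lintegral_const_mul _ (Measurable.indicator (by fun_prop)
            (measurableSet_lt ENNReal.measurable_ofReal measurable_const))]
          refine lintegral_congr fun t => ?_
          by_cases ht : ENNReal.ofReal t < h x <;> simp [indicator, ht]
      _ = _ := by
          rw [lintegral_lintegral_swap hmeas.aemeasurable]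
          refine lintegral_congr fun t => ?_
          rw [← lintegral_const_mul' _ _ ENNReal.ofReal_ne_top]
          refine lintegral_congr fun x => ?_
          by_cases ht : ENNReal.ofReal t < h x <;> simp [indicator, ht, mul_comm]
  have hM := measurable_maxFX_zero μ f
  calc ∫⁻ x, maxFX μ 0 f x ^ p ∂μ
      = ENNReal.ofReal p * ∫⁻ x, 1 * (∫⁻ t in Ioi (0 : ℝ),
          {t | ENNReal.ofReal t < maxFX μ 0 f x}.indicator
            (fun t => ENNReal.ofReal (t ^ (p - 1))) t) ∂μ := by
        rw [← lintegral_const_mul' _ _ ENNReal.ofReal_ne_top]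
        refine lintegral_congr fun x => ?_
        rw [lintegral_Ioi_indicator_rpow hp0, one_mul, ENNReal.mul_div_cancel
          (ENNReal.ofReal_pos.2 hp0).ne' ENNReal.ofReal_ne_top]
    _ = ENNReal.ofReal p * ∫⁻ t in Ioi (0 : ℝ), ENNReal.ofReal (t ^ (p - 1)) *
          ∫⁻ x, {x | ENNReal.ofReal t < maxFX μ 0 f x}.indicator 1 x ∂μ := by
        rw [hswap p _ (fun _ => 1) hM measurable_const]
        rfl
    _ ≤ ENNReal.ofReal p * ∫⁻ t in Ioi (0 : ℝ), (2 * (D : ℝ≥0∞) ^ 3) *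
          (ENNReal.ofReal (t ^ (p - 1 - 1)) *
            ∫⁻ x, {x | ENNReal.ofReal t < 2 * f x}.indicator f x ∂μ) := by
        gcongr ENNReal.ofReal p * ?_
        refine setLIntegral_mono' measurableSet_Ioi fun t ht => ?_
        have ht : 0 < t := ht
        rw [lintegral_indicator_one (measurableSet_lt measurable_const hM)]
        have hpow : ENNReal.ofReal (t ^ (p - 1)) =
            ENNReal.ofReal (t ^ (p - 1 - 1)) * ENNReal.ofReal t := by
          rw [← ENNReal.ofReal_mul (by positivity), ← Real.rpow_add_one ht.ne', sub_add_cancel]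
        rw [hpow, mul_assoc, mul_left_comm (2 * (D : ℝ≥0∞) ^ 3)]
        gcongr ENNReal.ofReal (t ^ (p - 1 - 1)) * ?_
        exact mul_measure_lt_maxFX_zero_le_indicator hpos hfin hD hcl hnd hgrowth hp hf
          (ENNReal.ofReal_pos.2 ht).ne' ENNReal.ofReal_ne_top
    _ = ENNReal.ofReal p * (2 * (D : ℝ≥0∞) ^ 3) * ∫⁻ x, f x *
          ((2 * f x) ^ (p - 1) / ENNReal.ofReal (p - 1)) ∂μ := by
        rw [lintegral_const_mul' _ _ (by finiteness), ← hswap (p - 1) (fun x => 2 * f x) f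
          (hfm.const_mul 2) hfm]
        simp only [lintegral_Ioi_indicator_rpow hp1, mul_assoc]
    _ = _ := by
        have hc : (2 : ℝ≥0∞) ^ (p - 1) / ENNReal.ofReal (p - 1) ≠ ∞ :=
          ENNReal.div_ne_top (by simp [ENNReal.rpow_eq_top_iff]) (ENNReal.ofReal_pos.2 hp1).ne'
        rw [mul_assoc _ (2 ^ (p - 1) / ENNReal.ofReal (p - 1)), ← lintegral_const_mul' _ _ hc]
        congr 1
        refine lintegral_congr fun x => ?_
        have hsplit : f x ^ p = f x * f x ^ (p - 1) := by
          nth_rw 2 [← ENNReal.rpow_one (f x)]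
          rw [← ENNReal.rpow_add_of_nonneg _ _ zero_le_one hp1.le, add_sub_cancel]
        rw [hsplit, ENNReal.mul_rpow_of_nonneg _ _ hp1.le, div_eq_mul_inv, div_eq_mul_inv]
        ring

/-- The fractional integral is dominated by a sum of averages over dyadic balls. -/
theorem TalphaE_le_tsum_avgBX {μ : Measure X}
    (hpos : ∀ (c : X) (r : ℝ), 0 < r → 0 < μ (ball c r)) {D : ℝ≥0}
    (hD : ∀ (c : X) (r : ℝ), 0 < r → μ (ball c (2 * r)) ≤ D * μ (ball c r))
    {α : ℝ} (hα : 0 < α) (f : X → ℝ≥0∞) (x : X) {R : ℝ} (hR : 0 < R) :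
    TalphaE μ α f x ≤
      D * ∑' k : ℤ, ENNReal.ofReal ((2 ^ k * R) ^ α) * avgBX μ x (2 ^ k * R) f := by
  let A : ℤ → Set X := fun k => ball x (2 ^ k * R) \ ball x (2 ^ (k - 1) * R)
  have hcover : univ ⊆ {x} ∪ ⋃ k, A k := by
    intro y _
    rcases eq_or_ne y x with rfl | hy
    · exact .inl rfl
    · obtain ⟨n, hn1, hn2⟩ := exists_mem_Ico_zpow (div_pos (dist_pos.2 hy) hR) one_lt_two
      refine .inr (mem_iUnion.2 ⟨n + 1, ?_, ?_⟩)
      · exact mem_ball.2 ((div_lt_iff₀ hR).1 hn2)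
      · rw [add_sub_cancel_right, mem_ball, not_lt]
        exact (le_div_iff₀ hR).1 hn1
  have hA : ∀ k, ∫⁻ y in A k, ENNReal.ofReal (dist x y ^ α) / μ (ball x (dist x y)) * f y ∂μ ≤
      D * (ENNReal.ofReal ((2 ^ k * R) ^ α) * avgBX μ x (2 ^ k * R) f) := by
    intro k
    have hk : (0 : ℝ) < 2 ^ k * R := by positivity
    have hk1 : (0 : ℝ) < 2 ^ (k - 1) * R := by positivity
    have hdouble : (2 : ℝ) ^ k * R = 2 * (2 ^ (k - 1) * R) := by
      rw [zpow_sub_one₀ two_ne_zero]; ring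
    have hball := hpos x _ hk
    have hD0 : (D : ℝ≥0∞) ≠ 0 := by
      intro h0
      have h := hD x _ hk1
      rw [h0, zero_mul, ← hdouble] at h
      exact hball.not_ge h
    calc _ ≤ ∫⁻ y in A k, (ENNReal.ofReal ((2 ^ k * R) ^ α) *
          (D * (μ (ball x (2 ^ k * R)))⁻¹)) * f y ∂μ := by
          refine setLIntegral_mono' (measurableSet_ball.diff measurableSet_ball) fun y hy => ?_
          have h1 : dist x y < 2 ^ k * R := by simpa [dist_comm] using hy.1
          have h2 : 2 ^ (k - 1) * R ≤ dist x y := by simpa [dist_comm] using hy.2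
          rw [div_eq_mul_inv]
          gcongr
          calc (μ (ball x (dist x y)))⁻¹
              = D * (D * μ (ball x (dist x y)))⁻¹ := by
                rw [ENNReal.mul_inv (.inl hD0) (.inl coe_ne_top), ← mul_assoc,
                  ENNReal.mul_inv_cancel hD0 coe_ne_top, one_mul]
            _ ≤ D * (μ (ball x (2 ^ k * R)))⁻¹ := by
                gcongr
                rw [hdouble]
                refine (hD x _ hk1).trans ?_
                gcongr
      _ = (ENNReal.ofReal ((2 ^ k * R) ^ α) * (D * (μ (ball x (2 ^ k * R)))⁻¹)) *
          ∫⁻ y in A k, f y ∂μ := by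
          refine lintegral_const_mul' _ _ (ENNReal.mul_ne_top ENNReal.ofReal_ne_top
            (ENNReal.mul_ne_top coe_ne_top (ENNReal.inv_ne_top.2 hball.ne')))
      _ ≤ (ENNReal.ofReal ((2 ^ k * R) ^ α) * (D * (μ (ball x (2 ^ k * R)))⁻¹)) *
          ∫⁻ y in ball x (2 ^ k * R), f y ∂μ := by
          gcongr
          exact sdiff_subset
      _ = _ := by rw [avgBX]; ring
  calc TalphaE μ α f x
      = ∫⁻ y in univ, ENNReal.ofReal (dist x y ^ α) / μ (ball x (dist x y)) * f y ∂μ := by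
        rw [setLIntegral_univ]; rfl
    _ ≤ ∫⁻ y in {x} ∪ ⋃ k, A k,
          ENNReal.ofReal (dist x y ^ α) / μ (ball x (dist x y)) * f y ∂μ :=
        lintegral_mono_set hcover
    _ ≤ _ := lintegral_union_le _ _ _
    _ ≤ 0 + ∑' k, ∫⁻ y in A k,
          ENNReal.ofReal (dist x y ^ α) / μ (ball x (dist x y)) * f y ∂μ := by
        gcongr
        · simp [Real.zero_rpow hα.ne']
        · exact lintegral_iUnion_le _ _
    _ ≤ _ := by
        rw [zero_add, ← ENNReal.tsum_mul_left]
        exact ENNReal.tsum_le_tsum hA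

theorem summable_zpow_rpow_mul_min {α β : ℝ} (hα : 0 < α) (hαβ : α < β) :
    Summable fun k : ℤ => ((2 : ℝ) ^ k) ^ α * min 1 (((2 : ℝ) ^ k) ^ (-β)) := by
  refine Summable.of_nat_of_neg ?_ ?_
  · have hlt : (2 : ℝ) ^ (α - β) < 1 := Real.rpow_lt_one_of_one_lt_of_neg one_lt_two (by linarith)
    refine Summable.of_nonneg_of_le (fun n => by positivity) (fun n => ?_)
      (summable_geometric_of_lt_one (by positivity) hlt)
    calc ((2 : ℝ) ^ (n : ℤ)) ^ α * min 1 (((2 : ℝ) ^ (n : ℤ)) ^ (-β))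
        ≤ ((2 : ℝ) ^ (n : ℤ)) ^ α * ((2 : ℝ) ^ (n : ℤ)) ^ (-β) := by
          gcongr; exact min_le_right _ _
      _ = ((2 : ℝ) ^ (α - β)) ^ n := by
          rw [← Real.rpow_add (by positivity), ← sub_eq_add_neg, zpow_natCast,
            Real.rpow_pow_comm zero_le_two]
  · have hlt : (2 : ℝ) ^ (-α) < 1 := Real.rpow_lt_one_of_one_lt_of_neg one_lt_two (by linarith)
    refine Summable.of_nonneg_of_le (fun n => by positivity) (fun n => ?_)
      (summable_geometric_of_lt_one (by positivity) hlt)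
    calc ((2 : ℝ) ^ (-n : ℤ)) ^ α * min 1 (((2 : ℝ) ^ (-n : ℤ)) ^ (-β))
        ≤ ((2 : ℝ) ^ (-n : ℤ)) ^ α * 1 := by
          gcongr; exact min_le_left _ _
      _ = ((2 : ℝ) ^ (-α)) ^ n := by
          rw [mul_one, zpow_neg, zpow_natCast, Real.inv_rpow (by positivity),
            ← Real.rpow_neg (by positivity), Real.rpow_pow_comm zero_le_two]

/-- Hedberg's pointwise inequality: control of the averages of `f` by a constant `m` and by
`a * r ^ (-β)` yields a bound of the fractional integral by a geometric mean of `m` and `a`. -/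
theorem exists_TalphaE_le_mul_rpow_mul_rpow {μ : Measure X}
    (hpos : ∀ (c : X) (r : ℝ), 0 < r → 0 < μ (ball c r)) {D : ℝ≥0}
    (hD : ∀ (c : X) (r : ℝ), 0 < r → μ (ball c (2 * r)) ≤ D * μ (ball c r))
    {α β : ℝ} (hα : 0 < α) (hαβ : α < β) :
    ∃ C : ℝ≥0, ∀ (f : X → ℝ≥0∞) (x : X) (m a : ℝ≥0∞),
      (∀ r, 0 < r → avgBX μ x r f ≤ m) →
      (∀ r, 0 < r → avgBX μ x r f ≤ a * ENNReal.ofReal (r ^ (-β))) →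
      TalphaE μ α f x ≤ C * m ^ (1 - α / β) * a ^ (α / β) := by
  have hβ : 0 < β := hα.trans hαβ
  have hθ : 0 < α / β := div_pos hα hβ
  have hθ1 : 0 < 1 - α / β := sub_pos.2 ((div_lt_one hβ).2 hαβ)
  set S : ℝ := ∑' k : ℤ, ((2 : ℝ) ^ k) ^ α * min 1 (((2 : ℝ) ^ k) ^ (-β)) with hS
  refine ⟨D * S.toNNReal + 1, fun f x m a hm ha => ?_⟩
  have hzero : (∀ r, 0 < r → avgBX μ x r f = 0) → TalphaE μ α f x = 0 := by
    intro h
    refine le_antisymm ((TalphaE_le_tsum_avgBX hpos hD hα f x one_pos).trans ?_) zero_le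
    have : ∀ k : ℤ, avgBX μ x (2 ^ k) f = 0 := fun k => h _ (by positivity)
    simp [this]
  rcases eq_or_ne m 0 with rfl | hm0
  · rw [hzero fun r hr => le_antisymm (hm r hr) zero_le]
    exact zero_le
  rcases eq_or_ne a 0 with rfl | ha0
  · rw [hzero fun r hr => le_antisymm ((ha r hr).trans (by simp)) zero_le]
    exact zero_le
  have hC0 : ((D * S.toNNReal + 1 : ℝ≥0) : ℝ≥0∞) ≠ 0 := by simp
  have hmθ : m ^ (1 - α / β) ≠ 0 := by
    simp [ENNReal.rpow_eq_zero_iff, hm0, hθ1.not_gt]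
  have haθ : a ^ (α / β) ≠ 0 := by
    simp [ENNReal.rpow_eq_zero_iff, ha0, hθ.not_gt]
  rcases eq_or_ne m ∞ with rfl | hm'
  · rw [ENNReal.top_rpow_of_pos hθ1, ENNReal.mul_top hC0, ENNReal.top_mul haθ]
    exact le_top
  rcases eq_or_ne a ∞ with rfl | ha'
  · rw [ENNReal.top_rpow_of_pos hθ, ENNReal.mul_top (mul_ne_zero hC0 hmθ)]
    exact le_top
  lift m to ℝ≥0 using hm'
  lift a to ℝ≥0 using ha'
  have hm0 : 0 < (m : ℝ) := by exact_mod_cast pos_iff_ne_zero.2 hm0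
  have ha0 : 0 < (a : ℝ) := by exact_mod_cast pos_iff_ne_zero.2 ha0
  set R : ℝ := ((a : ℝ) / m) ^ β⁻¹ with hRdef
  have hR : 0 < R := by positivity
  have hRβ : m * R ^ β = a := by
    rw [hRdef, Real.rpow_inv_rpow (by positivity) hβ.ne', mul_div_cancel₀ _ hm0.ne']
  have hRα : (m : ℝ) * R ^ α = m ^ (1 - α / β) * (a : ℝ) ^ (α / β) := by
    rw [hRdef, ← Real.rpow_mul (by positivity), inv_mul_eq_div, Real.div_rpow ha0.le hm0.le,
      Real.rpow_sub hm0, Real.rpow_one]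
    ring
  have hterm : ∀ k : ℤ, ENNReal.ofReal ((2 ^ k * R) ^ α) * avgBX μ x (2 ^ k * R) f ≤
      ENNReal.ofReal (m * R ^ α) *
        ENNReal.ofReal (((2 : ℝ) ^ k) ^ α * min 1 (((2 : ℝ) ^ k) ^ (-β))) := by
    intro k
    have hk : (0 : ℝ) < 2 ^ k * R := by positivity
    have havg : avgBX μ x (2 ^ k * R) f ≤
        ENNReal.ofReal (m * min 1 (((2 : ℝ) ^ k) ^ (-β))) := by
      rw [mul_min_of_nonneg _ _ hm0.le, mul_one, ENNReal.ofReal_min, ENNReal.ofReal_coe_nnreal]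
      refine le_min (hm _ hk) ((ha _ hk).trans_eq ?_)
      rw [← ENNReal.ofReal_coe_nnreal (p := a), ← ENNReal.ofReal_mul ha0.le, ← hRβ,
        Real.mul_rpow (by positivity) hR.le, Real.rpow_neg hR.le]
      congr 1
      have : R ^ β ≠ 0 := by positivity
      field_simp
    calc _ ≤ ENNReal.ofReal ((2 ^ k * R) ^ α) *
          ENNReal.ofReal (m * min 1 (((2 : ℝ) ^ k) ^ (-β))) := by gcongr
      _ = _ := by
          rw [← ENNReal.ofReal_mul (by positivity), ← ENNReal.ofReal_mul (by positivity),
            Real.mul_rpow (by positivity) hR.le]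
          congr 1
          ring
  calc TalphaE μ α f x
      ≤ D * ∑' k : ℤ, ENNReal.ofReal ((2 ^ k * R) ^ α) * avgBX μ x (2 ^ k * R) f :=
        TalphaE_le_tsum_avgBX hpos hD hα f x hR
    _ ≤ D * ∑' k : ℤ, ENNReal.ofReal (m * R ^ α) *
        ENNReal.ofReal (((2 : ℝ) ^ k) ^ α * min 1 (((2 : ℝ) ^ k) ^ (-β))) := by
        gcongr D * ?_
        exact ENNReal.tsum_le_tsum hterm
    _ = (D * S.toNNReal : ℝ≥0) * ENNReal.ofReal (m * R ^ α) := by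
        rw [ENNReal.tsum_mul_left, ← ENNReal.ofReal_tsum_of_nonneg (fun k => by positivity)
          (summable_zpow_rpow_mul_min hα hαβ), ← hS, ENNReal.coe_mul, ENNReal.ofReal, ENNReal.ofReal]
        ring
    _ ≤ (D * S.toNNReal + 1 : ℝ≥0) * ENNReal.ofReal (m * R ^ α) := by
        gcongr
        exact le_self_add
    _ = _ := by
        rw [hRα, ENNReal.ofReal_mul (by positivity), ← ENNReal.ofReal_rpow_of_pos hm0,
          ← ENNReal.ofReal_rpow_of_pos ha0, ENNReal.ofReal_coe_nnreal, ENNReal.ofReal_coe_nnreal,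
          mul_assoc]

theorem setLIntegral_le_rpow_mul_measure_rpow {Y : Type*} [MeasurableSpace Y] (ν : Measure Y)
    {p : ℝ} (hp : 1 < p) {g : Y → ℝ≥0∞} (hg : Measurable g) (s : Set Y) :
    ∫⁻ y in s, g y ∂ν ≤ (∫⁻ y, g y ^ p ∂ν) ^ (1 / p) * ν s ^ (1 - 1 / p) := by
  have hpq := Real.HolderConjugate.conjExponent hp
  have hexp : 1 / p.conjExponent = 1 - 1 / p := by
    rw [one_div, one_div, hpq.one_sub_inv]
  have h := lintegral_mul_le_Lp_mul_Lq (ν.restrict s) hpq (f := g) (g := fun _ => 1)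
    hg.aemeasurable measurable_const.aemeasurable
  simp only [Pi.mul_apply, mul_one, ENNReal.one_rpow, lintegral_const, one_mul,
    Measure.restrict_apply_univ, hexp] at h
  refine h.trans ?_
  gcongr
  exact Measure.restrict_le_self

theorem avgBX_le_mul_rpow_neg {Y : Type*} [MetricSpace Y] [MeasurableSpace Y]
    {μ : Measure Y}
    (hpos : ∀ (c : Y) (r : ℝ), 0 < r → 0 < μ (ball c r))
    (hfin : ∀ (c : Y) (r : ℝ), 0 < r → μ (ball c r) < ∞)
    {cl nd : ℝ} (hcl : 0 < cl) (hgrowth : GrowthGE μ cl nd)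
    {p : ℝ} (hp : 1 < p) {g : Y → ℝ≥0∞} (hg : Measurable g) (x : Y) {r : ℝ} (hr : 0 < r) :
    avgBX μ x r g ≤ ENNReal.ofReal (cl ^ (-(1 / p))) * (∫⁻ y, g y ^ p ∂μ) ^ (1 / p) *
      ENNReal.ofReal (r ^ (-(nd / p))) := by
  have h0 := (hpos x r hr).ne'
  have h1 := (hfin x r hr).ne
  calc avgBX μ x r g
      ≤ (μ (ball x r))⁻¹ * ((∫⁻ y, g y ^ p ∂μ) ^ (1 / p) * μ (ball x r) ^ (1 - 1 / p)) := by
        unfold avgBX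
        gcongr
        exact setLIntegral_le_rpow_mul_measure_rpow μ hp hg _
    _ = (∫⁻ y, g y ^ p ∂μ) ^ (1 / p) * μ (ball x r) ^ (-(1 / p)) := by
        rw [mul_left_comm, ← ENNReal.rpow_neg_one, ← ENNReal.rpow_add _ _ h0 h1]
        congr 2
        ring
    _ ≤ (∫⁻ y, g y ^ p ∂μ) ^ (1 / p) * ENNReal.ofReal (cl * r ^ nd) ^ (-(1 / p)) := by
        gcongr _ * ?_
        rw [ENNReal.rpow_neg, ENNReal.rpow_neg]
        gcongr
        exact hgrowth x r hr
    _ = _ := by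
        rw [ENNReal.ofReal_rpow_of_pos (by positivity), Real.mul_rpow hcl.le (by positivity),
          ← Real.rpow_mul hr.le, ENNReal.ofReal_mul (by positivity)]
        have : nd * -(1 / p) = -(nd / p) := by ring
        rw [this]
        ring

theorem sigmaFinite_of_measure_ball_lt_top {Y : Type*} [MetricSpace Y] [MeasurableSpace Y]
    {μ : Measure Y}
    (hfin : ∀ (c : Y) (r : ℝ), 0 < r → μ (ball c r) < ∞) : SigmaFinite μ := by
  rcases isEmpty_or_nonempty Y with h | ⟨⟨x⟩⟩
  · rw [μ.eq_zero_of_isEmpty]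
    infer_instance
  · refine ⟨⟨⟨fun n : ℕ => ball x (n + 1), fun _ => trivial, fun n => hfin x _ (by positivity),
      eq_univ_of_forall fun y => ?_⟩⟩⟩
    obtain ⟨n, hn⟩ := exists_nat_gt (dist y x)
    exact mem_iUnion.2 ⟨n, mem_ball.2 (by linarith)⟩

theorem statement14
    (μ : Measure X) (hμ : IsSHT μ)
    (cl nd : ℝ) (hcl : 0 < cl) (hnd : 0 < nd) (hgrowth : GrowthGE μ cl nd)
    (α p q : ℝ) (hα0 : 0 < α) (hαn : α < nd)
    (hp1 : 1 < p) (hpn : p < nd / α) (hq : 1 / q = 1 / p - α / nd) :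
    ∃ C : ℝ≥0, ∀ f : X → ℝ,
      (∫⁻ x, (TalphaE μ α (fun y => (‖f y‖₊ : ℝ≥0∞)) x) ^ q ∂μ) ^ (1 / q) ≤
        C * (∫⁻ x, (‖f x‖₊ : ℝ≥0∞) ^ p ∂μ) ^ (1 / p) := by
  obtain ⟨hfin, hpos, D, hD⟩ := hμ
  have := sigmaFinite_of_measure_ball_lt_top hfin
  have hp0 : 0 < p := by linarith
  have hαp : α * p < nd := by rwa [lt_div_iff₀ hα0, mul_comm] at hpn
  have hβ : 0 < nd / p := by positivity
  have hαβ : α < nd / p := (lt_div_iff₀ hp0).2 hαp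
  have hq0 : 0 < q := by
    refine one_div_pos.1 ?_
    rw [hq, sub_pos, div_lt_div_iff₀ hnd hp0, one_mul]
    exact hαp
  set θ : ℝ := α / (nd / p) with hθ
  have hθ0 : 0 < θ := by positivity
  have hθq : (1 - θ) * q = p := by
    have hne := hq0.ne'
    have h1 : p * (1 / q) = 1 - θ := by
      rw [hq, hθ]
      field_simp
    rw [← h1]
    field_simp
  obtain ⟨C, hC⟩ := exists_TalphaE_le_mul_rpow_mul_rpow hpos hD hα0 hαβ
  set c : ℝ≥0∞ := ENNReal.ofReal (cl ^ (-(1 / p)))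
  set A : ℝ≥0∞ := ENNReal.ofReal p * (2 * (D : ℝ≥0∞) ^ 3) *
    (2 ^ (p - 1) / ENNReal.ofReal (p - 1))
  have hA_top : A ≠ ∞ := by
    refine ENNReal.mul_ne_top (by finiteness) (ENNReal.div_ne_top ?_ ?_)
    · simp [ENNReal.rpow_eq_top_iff]
    · exact (ENNReal.ofReal_pos.2 (by linarith)).ne'
  have hK_top : C * c ^ θ * A ^ (1 / q) ≠ ∞ := by
    refine ENNReal.mul_ne_top (ENNReal.mul_ne_top coe_ne_top ?_) ?_
    · exact ENNReal.rpow_ne_top_of_nonneg hθ0.le ENNReal.ofReal_ne_top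
    · exact ENNReal.rpow_ne_top_of_nonneg (by positivity) hA_top
  refine ⟨(C * c ^ θ * A ^ (1 / q)).toNNReal + 1, fun f => ?_⟩
  set F : X → ℝ≥0∞ := fun y => (‖f y‖₊ : ℝ≥0∞)
  obtain ⟨g, hgm, hgF, hint⟩ := exists_measurable_le_forall_setLIntegral_eq μ F
  have havg : ∀ x r, avgBX μ x r F = avgBX μ x r g := fun x r => by rw [avgBX, avgBX, hint]
  set J : ℝ≥0∞ := ∫⁻ x, g x ^ p ∂μ
  have hJF : J ≤ ∫⁻ x, F x ^ p ∂μ := by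
    refine lintegral_mono fun x => ?_
    gcongr
    exact hgF x
  rcases eq_or_ne J ∞ with hJtop | hJtop
  · rw [hJtop, top_le_iff] at hJF
    change _ ≤ _ * (∫⁻ x, F x ^ p ∂μ) ^ (1 / p)
    rw [hJF, ENNReal.top_rpow_of_pos (by positivity), ENNReal.mul_top (by simp)]
    exact le_top
  have hpoint : ∀ x, TalphaE μ α F x ≤
      C * maxFX μ 0 g x ^ (1 - θ) * (c * J ^ (1 / p)) ^ θ := fun x =>
    hC F x _ _ (fun r hr => (havg x r).trans_le (avgBX_le_maxFX_zero x hr))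
      (fun r hr => (havg x r).trans_le
        (avgBX_le_mul_rpow_neg hpos hfin hcl hgrowth hp1 hgm x hr))
  have hB_top : (C * (c * J ^ (1 / p)) ^ θ) ^ q ≠ ∞ := by
    refine ENNReal.rpow_ne_top_of_nonneg hq0.le (ENNReal.mul_ne_top coe_ne_top
      (ENNReal.rpow_ne_top_of_nonneg hθ0.le (ENNReal.mul_ne_top ENNReal.ofReal_ne_top
        (ENNReal.rpow_ne_top_of_nonneg (by positivity) hJtop))))
  calc (∫⁻ x, TalphaE μ α F x ^ q ∂μ) ^ (1 / q)
      ≤ (∫⁻ x, (C * (c * J ^ (1 / p)) ^ θ) ^ q * maxFX μ 0 g x ^ p ∂μ) ^ (1 / q) := by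
        gcongr with x
        calc TalphaE μ α F x ^ q
            ≤ (C * maxFX μ 0 g x ^ (1 - θ) * (c * J ^ (1 / p)) ^ θ) ^ q := by
              gcongr
              exact hpoint x
          _ = _ := by
              rw [mul_right_comm, ENNReal.mul_rpow_of_nonneg _ _ hq0.le,
                ← ENNReal.rpow_mul (maxFX μ 0 g x), hθq]
    _ ≤ ((C * (c * J ^ (1 / p)) ^ θ) ^ q * (A * J)) ^ (1 / q) := by
        rw [lintegral_const_mul' _ _ hB_top]
        gcongr
        exact lintegral_maxFX_zero_rpow_le hpos hfin hD hcl hnd hgrowth hp1 hgm hJtop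
    _ = C * c ^ θ * A ^ (1 / q) * J ^ (1 / p) := by
        have hexp : 1 / p = 1 / p * θ + 1 / q := by
          rw [hq, hθ]
          field_simp
          ring
        have hq1 : 0 ≤ 1 / q := by positivity
        have hJsplit : J ^ (1 / p) = J ^ (1 / p * θ) * J ^ (1 / q) := by
          rw [← ENNReal.rpow_add_of_nonneg _ _ (by positivity) hq1, ← hexp]
        rw [ENNReal.mul_rpow_of_nonneg _ _ hq1, ← ENNReal.rpow_mul,
          mul_one_div_cancel hq0.ne', ENNReal.rpow_one, ENNReal.mul_rpow_of_nonneg _ _ hθ0.le,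
          ENNReal.mul_rpow_of_nonneg _ _ hq1, ← ENNReal.rpow_mul, hJsplit]
        ring
    _ ≤ _ := by
        rw [ENNReal.coe_add, ENNReal.coe_toNNReal hK_top]
        gcongr
        exact le_self_add
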